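/- For every n ∈ ℕ₀, the real vector space of homogeneous polynomials of degree n in three variables that are harmonic (i.e., annihilated by the Laplace operator ∂²/∂x₁² + ∂²/∂x₂² + ∂²/∂x₃²) has dimension 2n+1. -/

import Mathlib

noncomputable section

/-- The formal Laplace operator `∂²/∂x₁² + ∂²/∂x₂² + ∂²/∂x₃²` on polynomials in three
variables, as a linear map. -/
def polyLaplacian : MvPolynomial (Fin 3) ℝ →ₗ[ℝ] MvPolynomial (Fin 3) ℝ :=
  ∑ i : Fin 3, (MvPolynomial.pderiv i).toLinearMap ∘ₗ (MvPolynomial.pderiv i).toLinearMap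

/-- The space of harmonic homogeneous polynomials of degree `n` in three variables. -/
def harmonicHomogeneous (n : ℕ) : Submodule ℝ (MvPolynomial (Fin 3) ℝ) :=
  MvPolynomial.homogeneousSubmodule (Fin 3) ℝ n ⊓ LinearMap.ker polyLaplacian

end

noncomputable section

open MvPolynomial

/-- The exponent vector `(a, b, d)`. -/
def exponent (a b d : ℕ) : Fin 3 →₀ ℕ := Finsupp.equivFunOnFinite.symm ![a, b, d]

@[simp] lemma exponent_apply_zero (a b d : ℕ) : exponent a b d 0 = a := rfl

@[simp] lemma exponent_apply_one (a b d : ℕ) : exponent a b d 1 = b := rfl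

@[simp] lemma exponent_apply_two (a b d : ℕ) : exponent a b d 2 = d := rfl

lemma exponent_eta (m : Fin 3 →₀ ℕ) : exponent (m 0) (m 1) (m 2) = m := by
  ext i; fin_cases i <;> rfl

lemma degree_eq_add (m : Fin 3 →₀ ℕ) : m.degree = m 0 + m 1 + m 2 := by
  rw [Finsupp.degree_eq_sum, Fin.sum_univ_three]

lemma coeff_polyLaplacian (p : MvPolynomial (Fin 3) ℝ) (a b d : ℕ) :
    coeff (exponent a b d) (polyLaplacian p) =
      (a + 2) * (a + 1) * coeff (exponent (a + 2) b d) p +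
      (b + 2) * (b + 1) * coeff (exponent a (b + 2) d) p +
      (d + 2) * (d + 1) * coeff (exponent a b (d + 2)) p := by
  have h₀ : exponent a b d + Finsupp.single 0 1 + Finsupp.single 0 1 = exponent (a + 2) b d := by
    ext i; fin_cases i <;> simp
  have h₁ : exponent a b d + Finsupp.single 1 1 + Finsupp.single 1 1 = exponent a (b + 2) d := by
    ext i; fin_cases i <;> simp
  have h₂ : exponent a b d + Finsupp.single 2 1 + Finsupp.single 2 1 = exponent a b (d + 2) := by
    ext i; fin_cases i <;> simp
  simp [polyLaplacian, Fin.sum_univ_three, coeff_pderiv, h₀, h₁, h₂]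
  ring

lemma polyLaplacian_eq_zero_iff (p : MvPolynomial (Fin 3) ℝ) :
    polyLaplacian p = 0 ↔ ∀ a b d : ℕ,
      (a + 2) * (a + 1) * coeff (exponent (a + 2) b d) p +
      (b + 2) * (b + 1) * coeff (exponent a (b + 2) d) p +
      (d + 2) * (d + 1) * coeff (exponent a b (d + 2)) p = 0 := by
  simp only [← coeff_polyLaplacian]
  refine ⟨fun h a b d => by simp [h], fun h => ?_⟩
  ext m
  rw [← exponent_eta m, h, coeff_zero]

/-- The coefficients of the formal harmonic power series whose coefficients of order `0` and `1`
in the first variable are `u` and `v`. -/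
def harmonicExtension (u v : ℕ → ℕ → ℝ) : ℕ → ℕ → ℕ → ℝ
  | 0, b, d => u b d
  | 1, b, d => v b d
  | a + 2, b, d =>
    -((b + 2) * (b + 1) * harmonicExtension u v a (b + 2) d +
      (d + 2) * (d + 1) * harmonicExtension u v a b (d + 2)) / ((a + 2) * (a + 1))

lemma harmonicExtension_eq_zero {u v : ℕ → ℕ → ℝ} {n : ℕ}
    (hu : ∀ b d, b + d ≠ n → u b d = 0) (hv : ∀ b d, 1 + b + d ≠ n → v b d = 0) (a b d : ℕ)
    (h : a + b + d ≠ n) : harmonicExtension u v a b d = 0 := by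
  induction a using Nat.twoStepInduction generalizing b d with
  | zero => exact hu b d (by omega)
  | one => exact hv b d h
  | more a ih _ =>
    rw [harmonicExtension, ih (b + 2) d (by omega), ih b (d + 2) (by omega)]
    simp

lemma exists_mem_harmonicHomogeneous {u v : ℕ → ℕ → ℝ} {n : ℕ}
    (hu : ∀ b d, b + d ≠ n → u b d = 0) (hv : ∀ b d, 1 + b + d ≠ n → v b d = 0) :
    ∃ p ∈ harmonicHomogeneous n,
      ∀ b d, coeff (exponent 0 b d) p = u b d ∧ coeff (exponent 1 b d) p = v b d := by
  have hc := harmonicExtension_eq_zero hu hv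
  let p : MvPolynomial (Fin 3) ℝ := ∑ m ∈ Finset.finsuppAntidiag Finset.univ n,
    monomial m (harmonicExtension u v (m 0) (m 1) (m 2))
  have hp (m) : coeff m p = harmonicExtension u v (m 0) (m 1) (m 2) := by
    simp only [p, coeff_sum, coeff_monomial, Finset.sum_ite_eq', Finset.mem_finsuppAntidiag,
      Fin.sum_univ_three]
    split_ifs with h
    · rfl
    · exact (hc _ _ _ fun h' => h ⟨h', Finset.subset_univ _⟩).symm
  refine ⟨p, ⟨fun m hm => ?_, ?_⟩, fun b d => ⟨by simp [hp, harmonicExtension],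
    by simp [hp, harmonicExtension]⟩⟩
  · refine (DFunLike.congr_fun Finsupp.degree_eq_weight_one m).symm.trans ?_
    rw [degree_eq_add]
    by_contra h
    exact hm ((hp m).trans (hc _ _ _ h))
  · rw [SetLike.mem_coe, LinearMap.mem_ker, polyLaplacian_eq_zero_iff]
    intro a b d
    simp only [hp, exponent_apply_zero, exponent_apply_one, exponent_apply_two]
    rw [harmonicExtension]
    field_simp
    ring

lemma eq_zero_of_mem_harmonicHomogeneous {n : ℕ} {p : MvPolynomial (Fin 3) ℝ}
    (hp : p ∈ harmonicHomogeneous n)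
    (h₀ : ∀ b d, b + d = n → coeff (exponent 0 b d) p = 0)
    (h₁ : ∀ b d, 1 + b + d = n → coeff (exponent 1 b d) p = 0) : p = 0 := by
  obtain ⟨hom, hker⟩ := hp
  have hrec := (polyLaplacian_eq_zero_iff p).1 hker
  have hdeg (a b d) (h : a + b + d ≠ n) : coeff (exponent a b d) p = 0 :=
    IsHomogeneous.coeff_eq_zero hom (by rwa [degree_eq_add])
  have key (a b d) : coeff (exponent a b d) p = 0 := by
    induction a using Nat.twoStepInduction generalizing b d with
    | zero => exact (em (b + d = n)).elim (h₀ b d) fun h => hdeg 0 b d (by omega)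
    | one => exact (em (1 + b + d = n)).elim (h₁ b d) (hdeg 1 b d)
    | more a ih _ =>
      have h := hrec a b d
      rw [ih, ih, mul_zero, mul_zero, add_zero, add_zero] at h
      exact (mul_eq_zero.1 h).resolve_left (by positivity)
  ext m
  rw [← exponent_eta m, key, coeff_zero]

/-- The coefficients of order `0` and `1` in the first variable of a harmonic homogeneous
polynomial of degree `n`. -/
def cauchyData (n : ℕ) : harmonicHomogeneous n →ₗ[ℝ] (Fin (n + 1) ⊕ Fin n → ℝ) :=
  LinearMap.pi (Sum.elim (fun i => lcoeff ℝ (exponent 0 i (n - i)))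
    (fun i => lcoeff ℝ (exponent 1 i (n - 1 - i)))) ∘ₗ (harmonicHomogeneous n).subtype

lemma cauchyData_apply_inl {n : ℕ} (p : harmonicHomogeneous n) (i : Fin (n + 1)) :
    cauchyData n p (Sum.inl i) = coeff (exponent 0 i (n - i)) p.1 := rfl

lemma cauchyData_apply_inr {n : ℕ} (p : harmonicHomogeneous n) (i : Fin n) :
    cauchyData n p (Sum.inr i) = coeff (exponent 1 i (n - 1 - i)) p.1 := rfl

lemma cauchyData_injective (n : ℕ) : Function.Injective (cauchyData n) := by
  rw [injective_iff_map_eq_zero]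
  refine fun p hp => Subtype.ext (eq_zero_of_mem_harmonicHomogeneous p.2 ?_ ?_)
  · rintro b d rfl
    simpa [cauchyData_apply_inl] using congrFun hp (Sum.inl ⟨b, by omega⟩)
  · rintro b d rfl
    have := congrFun hp (Sum.inr ⟨b, by omega⟩)
    rw [cauchyData_apply_inr] at this
    rwa [show 1 + b + d - 1 - b = d by omega] at this

lemma cauchyData_surjective (n : ℕ) : Function.Surjective (cauchyData n) := by
  intro f
  obtain ⟨p, hp, h⟩ := exists_mem_harmonicHomogeneous (n := n)
    (u := fun b d => if hb : b + d = n then f (Sum.inl ⟨b, by omega⟩) else 0)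
    (v := fun b d => if hb : 1 + b + d = n then f (Sum.inr ⟨b, by omega⟩) else 0)
    (fun b d hb => dif_neg hb) (fun b d hb => dif_neg hb)
  refine ⟨⟨p, hp⟩, funext ?_⟩
  rintro (i | i)
  · rw [cauchyData_apply_inl, (h _ _).1, dif_pos (by omega)]
  · rw [cauchyData_apply_inr, (h _ _).2, dif_pos (by omega)]

end

/-- the space of harmonic homogeneous polynomials of degree `n` in three
variables has dimension `2n + 1`. -/
theorem finrank_harmonicHomogeneous (n : ℕ) :
    Module.finrank ℝ (harmonicHomogeneous n) = 2 * n + 1 := by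
  rw [(LinearEquiv.ofBijective (cauchyData n)
    ⟨cauchyData_injective n, cauchyData_surjective n⟩).finrank_eq, Module.finrank_fintype_fun_eq_card,
    Fintype.card_sum, Fintype.card_fin, Fintype.card_fin]
  ring
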